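/- Let H be a tree with a distinguished vertex u, let T_r be any tree on r ≥ 1 vertices disjoint from H with a distinguished vertex v, let G_1 be the tree obtained from the disjoint union of H and T_r by adding the edge uv, and let G_2 be the tree obtained from H by attaching r pendant edges at u. Then π(G_1) ≥ π(G_2). -/

import Mathlib

open scoped Classical

/-- Permanent of the Laplacian matrix of `G` (over `ℝ`). -/
noncomputable def permL {V : Type*} [Fintype V] (G : SimpleGraph V) : ℝ :=
  (G.lapMatrix ℝ).permanent

/-- Product of the degrees of all vertices of `G`. -/
noncomputable def PD {V : Type*} [Fintype V] (G : SimpleGraph V) : ℝ :=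
  ∏ v, (G.degree v : ℝ)

/-- The Laplacian ratio `π(G) = per L(G) / PD(G)`. -/
noncomputable def lapRatio {V : Type*} [Fintype V] (G : SimpleGraph V) : ℝ :=
  permL G / PD G

/-- The product of the degrees of the two endpoints of an edge `e`. -/
noncomputable def edgeDeg {V : Type*} [Fintype V] (G : SimpleGraph V) (e : Sym2 V) : ℝ :=
  Sym2.lift ⟨fun a b => (G.degree a : ℝ) * (G.degree b : ℝ), fun _ _ => mul_comm _ _⟩ e

/-- `G₁`: the tree obtained from the disjoint union of `H` and `T` by adding the edge
joining `u ∈ V(H)` to `v ∈ V(T)`. -/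
def joinTrees {α β : Type*} (H : SimpleGraph α) (T : SimpleGraph β) (u : α) (v : β) :
    SimpleGraph (α ⊕ β) :=
  (H ⊕g T) ⊔ SimpleGraph.fromEdgeSet {s(Sum.inl u, Sum.inr v)}

/-- `G₂`: the tree obtained from `H` by attaching a pendant edge at `u` for every `b : β`. -/
def attachPendants {α : Type*} (β : Type*) (H : SimpleGraph α) (u : α) :
    SimpleGraph (α ⊕ β) :=
  (H ⊕g (⊥ : SimpleGraph β)) ⊔
    SimpleGraph.fromEdgeSet {e | ∃ b : β, e = s(Sum.inl u, Sum.inr b)}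

namespace Matrix

section Permanent

variable {m n R : Type*} [DecidableEq m] [Fintype m] [DecidableEq n] [Fintype n]

theorem permanent_updateCol_add [CommSemiring R] (M : Matrix n n R) (j : n) (x y : n → R) :
    (M.updateCol j (x + y)).permanent =
      (M.updateCol j x).permanent + (M.updateCol j y).permanent := by
  simp only [permanent, ← Finset.sum_add_distrib]
  refine Finset.sum_congr rfl fun σ _ ↦ ?_
  have h : ∀ z : n → R, ∏ i ∈ Finset.univ.erase j, M.updateCol j z (σ i) i =
      ∏ i ∈ Finset.univ.erase j, M (σ i) i := fun z ↦
    Finset.prod_congr rfl fun i hi ↦ updateCol_ne (Finset.ne_of_mem_erase hi)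
  simp only [← Finset.mul_prod_erase _ _ (Finset.mem_univ j), updateCol_self, h, Pi.add_apply,
    add_mul]

theorem permanent_updateCol_one [CommSemiring R] (j : n) (x : n → R) :
    ((1 : Matrix n n R).updateCol j x).permanent = x j := by
  rw [permanent, Finset.sum_eq_single 1]
  · rw [← Finset.mul_prod_erase _ _ (Finset.mem_univ j), Finset.prod_eq_one]
    · simp
    · intro i hi
      simp [updateCol_ne (Finset.ne_of_mem_erase hi)]
  · intro σ _ hσ
    obtain ⟨i, hij, hi⟩ : ∃ i, i ≠ j ∧ σ i ≠ i := by
      by_contra! h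
      refine hσ (Equiv.ext fun i ↦ ?_)
      by_cases hij : i = j
      · by_contra hne
        have := h (σ i) (fun h' ↦ hne (by rw [h', hij]; rfl))
        exact hne (σ.injective this)
      · exact h i hij
    exact Finset.prod_eq_zero (Finset.mem_univ i) (by simp [updateCol_ne hij, one_apply_ne hi])
  · simp

theorem permanent_fromBlocks_zero₂₁ [CommSemiring R]
    (A : Matrix m m R) (B : Matrix m n R) (D : Matrix n n R) :
    (fromBlocks A B 0 D).permanent = A.permanent * D.permanent := by
  simp only [permanent]
  rw [Finset.sum_mul_sum, ← Finset.sum_product']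
  symm
  refine Finset.sum_of_injOn (fun σ : Equiv.Perm m × Equiv.Perm n ↦ σ.1.sumCongr σ.2)
    (Equiv.Perm.sumCongrHom_injective.injOn) (by simp) ?_ ?_
  · intro σ _ hσ
    obtain ⟨a, ha⟩ : ∃ a, ∀ y, Sum.inl y ≠ σ (Sum.inl a) := by
      by_contra! h
      have : σ ∈ (Equiv.Perm.sumCongrHom m n).range :=
        Equiv.Perm.mem_sumCongrHom_range_of_perm_mapsTo_inl (by
          rintro _ ⟨a, rfl⟩
          exact h a)
      obtain ⟨τ, rfl⟩ := this
      exact hσ ⟨τ, by simp, rfl⟩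
    refine Finset.prod_eq_zero (Finset.mem_univ (Sum.inl a)) ?_
    rcases hx : σ (Sum.inl a) with b | b
    · exact absurd hx.symm (ha b)
    · simp
  · rintro ⟨σ, τ⟩ _
    simp [Fintype.prod_sum_type]

theorem permanent_fromBlocks_single_row_col [CommSemiring R] (A : Matrix m m R) (D : Matrix n n R)
    (u : m) (b c : n → R) (s : Finset n) :
    (fromBlocks A (of fun i j ↦ if i = u ∧ j ∈ s then b j else 0)
        (of fun j i ↦ if i = u then c j else 0) D).permanent =
      A.permanent * D.permanent +
        (A.updateCol u (Pi.single u 1)).permanent *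
          ∑ j ∈ s, b j * (D.updateCol j c).permanent := by
  induction s using Finset.induction_on with
  | empty =>
    have : (of fun i j ↦ if i = u ∧ j ∈ (∅ : Finset n) then b j else 0) = (0 : Matrix m n R) := by
      ext; simp
    rw [this, ← permanent_transpose, fromBlocks_transpose, transpose_zero,
      permanent_fromBlocks_zero₂₁]
    simp
  | insert k s hk ih =>
    rw [Finset.sum_insert hk, mul_add, add_left_comm, ← ih]
    set M := fromBlocks A (of fun i j ↦ if i = u ∧ j ∈ s then b j else 0)
        (of fun j i ↦ if i = u then c j else 0) D
    have h₁ : fromBlocks A (of fun i j ↦ if i = u ∧ j ∈ insert k s then b j else 0)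
        (of fun j i ↦ if i = u then c j else 0) D =
        M.updateCol (Sum.inr k) ((fun i ↦ M i (Sum.inr k)) + b k • Pi.single (Sum.inl u) 1) := by
      ext (i | i) (j | j)
      · simp [M]
      · by_cases hj : j = k
        · subst hj
          by_cases hi : i = u <;> simp [M, hk, hi]
        · simp [M, hj]
      · simp [M]
      · by_cases hj : j = k
        · subst hj
          simp [M]
        · simp [M, hj]
    have h₂ : (M.updateCol (Sum.inr k) (Pi.single (Sum.inl u) 1)).submatrix id
          (Equiv.swap (Sum.inl u) (Sum.inr k)) =
        fromBlocks (A.updateCol u (Pi.single u 1))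
          ((of fun i j ↦ if i = u ∧ j ∈ s then b j else 0).updateCol k (fun i ↦ A i u)) 0
          (D.updateCol k c) := by
      ext (i | i) (j | j)
      · by_cases hj : j = u
        · subst hj
          simp [Pi.single_apply]
        · simp [Equiv.swap_apply_of_ne_of_ne, hj, M]
      · by_cases hj : j = k
        · subst hj
          simp [M]
        · simp [Equiv.swap_apply_of_ne_of_ne, hj, M]
      · by_cases hj : j = u
        · subst hj
          simp
        · simp [Equiv.swap_apply_of_ne_of_ne, hj, M]
      · by_cases hj : j = k
        · subst hj
          simp [M]
        · simp [Equiv.swap_apply_of_ne_of_ne, hj, M]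
    rw [h₁, permanent_updateCol_add, permanent_updateCol_smul,
      ← permanent_permute_rows (Equiv.swap (Sum.inl u) (Sum.inr k))
        (M.updateCol (Sum.inr k) (Pi.single (Sum.inl u) 1)), h₂, permanent_fromBlocks_zero₂₁]
    have h₃ : M.updateCol (Sum.inr k) (fun i ↦ M i (Sum.inr k)) = M := updateCol_eq_self M _
    rw [h₃]
    ring

theorem permanent_mul_mul_of_sq_eq_one [CommRing R] (M : Matrix n n R) (s : n → R)
    (hs : ∀ i, s i * s i = 1) :
    (of fun i j ↦ s i * s j * M i j).permanent = M.permanent := by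
  refine Finset.sum_congr rfl fun σ _ ↦ ?_
  simp only [of_apply, Finset.prod_mul_distrib]
  rw [Equiv.prod_comp σ s, ← Finset.prod_mul_distrib]
  simp [hs]

theorem permanent_nonneg {M : Matrix n n ℝ} (hM : ∀ i j, 0 ≤ M i j) : 0 ≤ M.permanent :=
  Finset.sum_nonneg fun _ _ ↦ Finset.prod_nonneg fun _ _ ↦ hM _ _

theorem prod_diag_le_permanent {M : Matrix n n ℝ} (hM : ∀ i j, 0 ≤ M i j) :
    ∏ i, M i i ≤ M.permanent :=
  Finset.single_le_sum (f := fun σ : Equiv.Perm n ↦ ∏ i, M (σ i) i)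
    (fun _ _ ↦ Finset.prod_nonneg fun _ _ ↦ hM _ _) (Finset.mem_univ 1)

end Permanent

end Matrix

theorem Finset.one_add_sum_le_prod_one_add_nat {ι : Type*} (s : Finset ι) (f : ι → ℕ) :
    1 + ∑ i ∈ s, f i ≤ ∏ i ∈ s, (1 + f i) := by
  induction s using Finset.induction_on with
  | empty => simp
  | insert a s ha ih =>
    rw [Finset.sum_insert ha, Finset.prod_insert ha]
    nlinarith [Nat.zero_le (f a * ∑ i ∈ s, f i)]

namespace SimpleGraph

variable {V : Type*} {G : SimpleGraph V}

/-- In a tree rooted at `v`, one endpoint of every edge is the parent of the other one. -/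
theorem IsTree.exists_parent (hG : G.IsTree) (v : V) :
    ∃ (p : V → V) (h : V → ℕ), p v = v ∧
      ∀ x y, G.Adj x y → y = p x ∨ (x = p y ∧ y ≠ v ∧ h x < h y) := by
  choose f hf hf' using (hG.existsUnique_path · v)
  have hv : f v = .nil := (hf' v _ .nil).symm
  refine ⟨fun x ↦ (f x).snd, fun x ↦ (f x).length, by simp [hv], fun x y hxy ↦ ?_⟩
  by_cases hy : y ∈ (f x).support
  · exact .inl (hG.isAcyclic.eq_snd_of_adj_start (hf x) hxy hy)
  · have hc : f y = .cons hxy.symm (f x) :=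
      (hf' y _ ((Walk.cons_isPath_iff _ _).2 ⟨hf x, hy⟩)).symm
    refine .inr ⟨by simp [hc], ?_, by simp [hc]⟩
    rintro rfl
    simp at hy

theorem IsTree.exists_sign (hG : G.IsTree) :
    ∃ s : V → ℝ, (∀ i, s i * s i = 1) ∧ ∀ i j, G.Adj i j → s i * s j = -1 := by
  obtain ⟨C⟩ := hG.colorable_two
  refine ⟨fun i ↦ if C i = 0 then 1 else -1, fun i ↦ by dsimp only; split_ifs <;> norm_num, fun i j hij ↦ ?_⟩
  have := C.valid hij
  by_cases hi : C i = 0 <;> by_cases hj : C j = 0 <;> simp only [hi, hj, if_true, if_false]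
  · exact absurd (hi.trans hj.symm) this
  · norm_num
  · norm_num
  · exact absurd ((by omega : C i = C j)) this

variable [Fintype V]

theorem degree_eq_sum_if_adj_nat (G : SimpleGraph V) (i : V) [Fintype (G.neighborSet i)] :
    G.degree i = ∑ j, if G.Adj i j then 1 else 0 := by
  rw [← Finset.card_filter, ← card_neighborFinset_eq_degree]
  congr 1
  ext
  simp

theorem IsTree.degree_pos_of_ne (hG : G.IsTree) {v w : V} (hw : w ≠ v) : 0 < G.degree w := by
  have : Nontrivial V := ⟨w, v, hw⟩
  exact hG.connected.preconnected.degree_pos_of_nontrivial w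

/-- The degree of `i` after attaching `k` pendant edges at `v`. -/
noncomputable def rootedDegree (G : SimpleGraph V) (v : V) (k : ℕ) (i : V) : ℕ :=
  G.degree i + if i = v then k else 0

theorem IsTree.card_le_prod_rootedDegree (hG : G.IsTree) (v : V) :
    Fintype.card V ≤ ∏ i, G.rootedDegree v 1 i := by
  have hpos : ∀ i, 1 ≤ G.rootedDegree v 1 i := fun i ↦ by
    unfold rootedDegree
    split_ifs with h
    · omega
    · have := hG.degree_pos_of_ne h
      omega
  have h₁ := Finset.one_add_sum_le_prod_one_add_nat Finset.univ fun i ↦ G.rootedDegree v 1 i - 1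
  have h₂ : ∑ i, G.rootedDegree v 1 i = ∑ i, (G.rootedDegree v 1 i - 1) + Fintype.card V := by
    rw [Fintype.card_eq_sum_ones, ← Finset.sum_add_distrib]
    exact Finset.sum_congr rfl fun i _ ↦ (Nat.sub_add_cancel (hpos i)).symm
  have h₃ : ∑ i, G.rootedDegree v 1 i = 2 * G.edgeFinset.card + 1 := by
    rw [← G.sum_degrees_eq_twice_card_edges]
    simp [rootedDegree, Finset.sum_add_distrib]
  have h₄ := hG.card_edgeFinset
  simp only [Nat.add_sub_cancel' (hpos _)] at h₁
  omega

/-- The entries are those of the signless Laplacian after attaching one pendant edge at `v`.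
The permanent counts pairs of a choice `f` of a neighbour (or of `v` itself, at `v`) for every
vertex and a permutation moving vertices only along `f`. -/
theorem IsTree.two_mul_prod_rootedDegree_le (hG : G.IsTree) (v : V) {M : Matrix V V ℝ}
    (hdiag : ∀ i, M i i = G.rootedDegree v 1 i) (hadj : ∀ i j, G.Adj i j → M i j = 1)
    (hnadj : ∀ i j, i ≠ j → ¬ G.Adj i j → M i j = 0) :
    2 * (∏ i, G.rootedDegree v 1 i : ℝ) ≤ M.permanent + 1 := by
  obtain ⟨p, h, hpv, hp⟩ := hG.exists_parent v
  let N : V → Finset V := fun i ↦ Finset.univ.filter fun w ↦ G.Adj i w ∨ (i = v ∧ w = v)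
  let P : Finset (V → V) := Fintype.piFinset N
  let r : Equiv.Perm V → (V → V) → Prop := fun σ f ↦ ∀ i, σ i = i ∨ σ i = f i
  have hN : ∀ i, (N i).card = G.rootedDegree v 1 i := by
    intro i
    by_cases hi : i = v
    · subst hi
      have : N i = insert i (G.neighborFinset i) := by ext; simp [N, or_comm]
      rw [this, Finset.card_insert_of_notMem (by simp)]
      simp [rootedDegree]
    · have : N i = G.neighborFinset i := by ext; simp [N, hi]
      simp [this, rootedDegree, hi]
  have hP : P.card = ∏ i, G.rootedDegree v 1 i := by
    simp only [P, Fintype.card_piFinset, hN]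
  have hentry : ∀ i j, M j i = ((N i).filter fun w ↦ j = i ∨ j = w).card := by
    intro i j
    by_cases hij : j = i
    · subst hij
      simp [hdiag, hN]
    · by_cases ha : G.Adj j i
      · have : ((N i).filter fun w ↦ j = i ∨ j = w) = {j} := by
          ext w
          simp only [N, hij, Finset.mem_filter, Finset.mem_univ, true_and, false_or,
            Finset.mem_singleton]
          exact ⟨fun h ↦ h.2.symm, fun h ↦ ⟨.inl (h ▸ ha.symm), h.symm⟩⟩
        rw [this, hadj j i ha]
        simp
      · have : ((N i).filter fun w ↦ j = i ∨ j = w) = ∅ := by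
          ext w
          simp only [N, hij, Finset.mem_filter, Finset.mem_univ, true_and, false_or,
            Finset.notMem_empty, iff_false, not_and]
          rintro (h | ⟨rfl, rfl⟩) rfl
          · exact ha h.symm
          · exact hij rfl
        rw [this, hnadj j i hij ha]
        simp
  have hperm : M.permanent = ((∑ σ : Equiv.Perm V, (P.bipartiteAbove r σ).card : ℕ) : ℝ) := by
    rw [Matrix.permanent, Nat.cast_sum]
    refine Finset.sum_congr rfl fun σ _ ↦ ?_
    simp only [hentry]
    rw [← Nat.cast_prod, ← Fintype.card_piFinset]
    congr 2
    ext f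
    simp [Finset.mem_bipartiteAbove, P, r, Fintype.mem_piFinset, forall_and]
  have hcount : ∀ f ∈ P,
      2 ≤ (Finset.univ.bipartiteBelow r f).card + if f = p then 1 else 0 := by
    intro f hf
    have hone : 1 ∈ Finset.univ.bipartiteBelow r f := by simp [Finset.mem_bipartiteBelow, r]
    split_ifs with hfp
    · have := Finset.card_pos.2 ⟨_, hone⟩
      omega
    obtain ⟨i, hi, hmax⟩ := (Finset.univ.filter fun i ↦ f i ≠ p i).exists_max_image h (by
      obtain ⟨i, hi⟩ := Function.ne_iff.1 hfp
      exact ⟨i, by simpa using hi⟩)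
    have hi' : f i ≠ p i := by simpa using hi
    have hai : G.Adj i (f i) := by
      have := Fintype.mem_piFinset.1 hf i
      simp only [N, Finset.mem_filter, Finset.mem_univ, true_and] at this
      rcases this with h | ⟨h, h'⟩
      · exact h
      · exact absurd (by rw [h', h, hpv]) hi'
    obtain ⟨hip, -, hlt⟩ := (hp i (f i) hai).resolve_left hi'
    have hback : f (f i) = i := by
      by_contra hne
      have := hmax (f i) (by simpa [← hip] using hne)
      omega
    have hswap : Equiv.swap i (f i) ∈ Finset.univ.bipartiteBelow r f := by
      simp only [Finset.mem_bipartiteBelow, Finset.mem_univ, true_and, r]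
      intro x
      by_cases hx : x = i
      · subst hx
        simp
      · by_cases hx' : x = f i
        · rw [hx', Equiv.swap_apply_right, hback]
          exact .inr rfl
        · exact .inl (Equiv.swap_apply_of_ne_of_ne hx hx')
    have : 1 < (Finset.univ.bipartiteBelow r f).card :=
      Finset.one_lt_card.2 ⟨_, hone, _, hswap, fun h ↦ hai.ne (by
        simpa using Equiv.ext_iff.1 h i)⟩
    omega
  have hsum : 2 * P.card ≤ ∑ σ : Equiv.Perm V, (P.bipartiteAbove r σ).card + 1 := by
    rw [Finset.sum_card_bipartiteAbove_eq_sum_card_bipartiteBelow]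
    calc 2 * P.card = ∑ f ∈ P, 2 := by simp [mul_comm]
      _ ≤ ∑ f ∈ P, ((Finset.univ.bipartiteBelow r f).card + if f = p then 1 else 0) :=
        Finset.sum_le_sum hcount
      _ ≤ _ := by
        rw [Finset.sum_add_distrib, Finset.sum_ite_eq']
        split_ifs <;> simp
  rw [hperm, ← Nat.cast_prod, ← hP]
  exact_mod_cast hsum

theorem prod_rootedDegree (G : SimpleGraph V) (v : V) (k : ℕ) :
    ∏ i, (G.rootedDegree v k i : ℝ) =
      (G.degree v + k) * ∏ i ∈ Finset.univ.erase v, (G.degree i : ℝ) := by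
  rw [← Finset.mul_prod_erase _ _ (Finset.mem_univ v)]
  congr 1
  · simp [rootedDegree]
  · exact Finset.prod_congr rfl fun i hi ↦ by simp [rootedDegree, Finset.ne_of_mem_erase hi]

/-- The principal block on `V` of the Laplacian after attaching `k` pendant edges at `v`. -/
noncomputable def rootedLap (G : SimpleGraph V) (v : V) (k : ℕ) : Matrix V V ℝ :=
  (G.lapMatrix ℝ).updateCol v ((fun i ↦ G.lapMatrix ℝ i v) + (k : ℝ) • Pi.single v 1)

/-- The permanent of the Laplacian with the row and the column of `v` deleted. -/
noncomputable def minorPermL (G : SimpleGraph V) (v : V) : ℝ :=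
  ((G.lapMatrix ℝ).updateCol v (Pi.single v 1)).permanent

theorem lapMatrix_apply_self (G : SimpleGraph V) [DecidableEq V] [DecidableRel G.Adj] (i : V) :
    G.lapMatrix ℝ i i = G.degree i := by
  simp [lapMatrix, degMatrix]

theorem lapMatrix_apply_of_ne (G : SimpleGraph V) [DecidableEq V] [DecidableRel G.Adj] {i j : V}
    (h : i ≠ j) :
    G.lapMatrix ℝ i j = if G.Adj i j then -1 else 0 := by
  simp only [lapMatrix, degMatrix, Matrix.sub_apply, Matrix.diagonal_apply_ne _ h,
    adjMatrix_apply]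
  split_ifs <;> simp

theorem rootedLap_apply (G : SimpleGraph V) (v : V) (k : ℕ) (i j : V) :
    G.rootedLap v k i j =
      if i = j then (G.rootedDegree v k i : ℝ) else if G.Adj i j then -1 else 0 := by
  unfold rootedLap rootedDegree
  by_cases hij : i = j
  · subst hij
    by_cases hi : i = v
    · subst hi
      simp [lapMatrix_apply_self]
    · simp [lapMatrix_apply_self, hi]
  · rw [if_neg hij, ← G.lapMatrix_apply_of_ne hij]
    by_cases hj : j = v
    · subst hj
      simp [hij]
    · simp [hj]

theorem permL_eq (G : SimpleGraph V) [DecidableEq V] [DecidableRel G.Adj] :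
    permL G = (G.lapMatrix ℝ).permanent := by
  unfold permL
  congr!

theorem permanent_rootedLap (G : SimpleGraph V) (v : V) (k : ℕ) :
    (G.rootedLap v k).permanent = permL G + k * G.minorPermL v := by
  rw [rootedLap, Matrix.permanent_updateCol_add, Matrix.permanent_updateCol_smul]
  congr 2
  exact Matrix.updateCol_eq_self _ _

theorem permanent_rootedLap_updateCol (G : SimpleGraph V) (v : V) (k : ℕ) :
    ((G.rootedLap v k).updateCol v (Pi.single v 1)).permanent = G.minorPermL v := by
  rw [rootedLap, Matrix.updateCol_idem, minorPermL]

theorem IsTree.one_le_prod_degree_erase (hG : G.IsTree) (v : V) :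
    1 ≤ ∏ i ∈ Finset.univ.erase v, (G.degree i : ℝ) := by
  have : 1 ≤ ∏ i ∈ Finset.univ.erase v, G.degree i :=
    Finset.one_le_prod' fun i hi ↦ hG.degree_pos_of_ne (Finset.ne_of_mem_erase hi)
  exact_mod_cast this

theorem IsTree.one_le_minorPermL (hG : G.IsTree) (v : V) : 1 ≤ G.minorPermL v := by
  obtain ⟨s, hs, hadj⟩ := hG.exists_sign
  rw [minorPermL, ← Matrix.permanent_mul_mul_of_sq_eq_one _ s hs]
  refine (hG.one_le_prod_degree_erase v).trans
    (le_trans (le_of_eq ?_) (Matrix.prod_diag_le_permanent fun i j ↦ ?_))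
  · rw [← Finset.mul_prod_erase _ _ (Finset.mem_univ v)]
    simp only [Matrix.of_apply, hs, one_mul, Matrix.updateCol_self, Pi.single_eq_same]
    exact Finset.prod_congr rfl fun i hi ↦ by
      rw [Matrix.updateCol_ne (Finset.ne_of_mem_erase hi), lapMatrix_apply_self]
  · by_cases hij : i = j
    · subst hij
      by_cases hi : i = v <;> simp [hi, hs, lapMatrix_apply_self]
    · by_cases hj : j = v
      · subst hj
        simp [hij]
      · by_cases ha : G.Adj i j <;>
          simp [Matrix.updateCol_ne hj, G.lapMatrix_apply_of_ne hij, ha, hadj]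

theorem IsTree.degree_mul_minorPermL_le (hG : G.IsTree) (v : V) :
    G.degree v * G.minorPermL v ≤ permL G := by
  obtain ⟨s, hs, hadj⟩ := hG.exists_sign
  set L := G.lapMatrix ℝ with hL
  have h : permL G = (L.updateCol v ((fun i ↦ L i v) - (G.degree v : ℝ) • Pi.single v 1)).permanent
      + G.degree v * G.minorPermL v := by
    rw [minorPermL, ← Matrix.permanent_updateCol_smul, ← Matrix.permanent_updateCol_add,
      sub_add_cancel, Matrix.updateCol_eq_self]
    rfl
  rw [h, le_add_iff_nonneg_left, ← Matrix.permanent_mul_mul_of_sq_eq_one _ s hs]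
  refine Matrix.permanent_nonneg fun i j ↦ ?_
  by_cases hij : i = j
  · subst hij
    by_cases hi : i = v
    · subst hi
      simp [hL, lapMatrix_apply_self]
    · simp [hi, hL, hs, lapMatrix_apply_self]
  · have : 0 ≤ s i * s j * L i j := by
      by_cases ha : G.Adj i j <;> simp [hL, G.lapMatrix_apply_of_ne hij, ha, hadj]
    by_cases hj : j = v
    · subst hj
      simpa [hij] using this
    · simpa [Matrix.updateCol_ne hj] using this

theorem IsTree.two_mul_prod_rootedDegree_le_permL (hG : G.IsTree) (v : V) :
    2 * (∏ i, G.rootedDegree v 1 i : ℝ) ≤ permL G + G.minorPermL v + 1 := by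
  obtain ⟨s, hs, hadj⟩ := hG.exists_sign
  have h := G.permanent_rootedLap v 1
  rw [Nat.cast_one, one_mul] at h
  rw [← h, ← Matrix.permanent_mul_mul_of_sq_eq_one _ s hs]
  refine hG.two_mul_prod_rootedDegree_le v (fun i ↦ ?_) (fun i j ha ↦ ?_) fun i j hij ha ↦ ?_
  · simp [rootedLap_apply, hs]
  · simp [rootedLap_apply, ha, ha.ne, hadj]
  · simp [rootedLap_apply, ha, hij]

end SimpleGraph

section Join

variable {α β : Type*} (H : SimpleGraph α) (T : SimpleGraph β)
  (u : α) (v : β)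

@[simp]
theorem joinTrees_adj_inl_inl (i j : α) :
    (joinTrees H T u v).Adj (.inl i) (.inl j) ↔ H.Adj i j := by
  simp [joinTrees]

@[simp]
theorem joinTrees_adj_inr_inr (i j : β) :
    (joinTrees H T u v).Adj (.inr i) (.inr j) ↔ T.Adj i j := by
  simp [joinTrees]

@[simp]
theorem joinTrees_adj_inl_inr (i : α) (j : β) :
    (joinTrees H T u v).Adj (.inl i) (.inr j) ↔ i = u ∧ j = v := by
  simp [joinTrees]

@[simp]
theorem joinTrees_adj_inr_inl (i : β) (j : α) :
    (joinTrees H T u v).Adj (.inr i) (.inl j) ↔ j = u ∧ i = v := by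
  rw [SimpleGraph.adj_comm, joinTrees_adj_inl_inr]

@[simp]
theorem attachPendants_adj_inl_inl (i j : α) :
    (attachPendants β H u).Adj (.inl i) (.inl j) ↔ H.Adj i j := by
  simp [attachPendants]

@[simp]
theorem attachPendants_adj_inr_inr (i j : β) :
    ¬ (attachPendants β H u).Adj (.inr i) (.inr j) := by
  simp [attachPendants]

@[simp]
theorem attachPendants_adj_inl_inr (i : α) (j : β) :
    (attachPendants β H u).Adj (.inl i) (.inr j) ↔ i = u := by
  simp [attachPendants]

@[simp]
theorem attachPendants_adj_inr_inl (i : β) (j : α) :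
    (attachPendants β H u).Adj (.inr i) (.inl j) ↔ j = u := by
  rw [SimpleGraph.adj_comm, attachPendants_adj_inl_inr]

variable [Fintype α] [Fintype β]

theorem degree_joinTrees_inl (i : α)
    [Fintype ((joinTrees H T u v).neighborSet (.inl i))] :
    (joinTrees H T u v).degree (.inl i) = H.rootedDegree u 1 i := by
  simp only [SimpleGraph.degree_eq_sum_if_adj_nat, Fintype.sum_sum_type, SimpleGraph.rootedDegree]
  by_cases hi : i = u <;> simp [hi]

theorem degree_joinTrees_inr (j : β)
    [Fintype ((joinTrees H T u v).neighborSet (.inr j))] :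
    (joinTrees H T u v).degree (.inr j) = T.rootedDegree v 1 j := by
  simp only [SimpleGraph.degree_eq_sum_if_adj_nat, Fintype.sum_sum_type, SimpleGraph.rootedDegree]
  by_cases hj : j = v <;> simp [hj, add_comm]

theorem degree_attachPendants_inl (i : α)
    [Fintype ((attachPendants β H u).neighborSet (.inl i))] :
    (attachPendants β H u).degree (.inl i) = H.rootedDegree u (Fintype.card β) i := by
  simp only [SimpleGraph.degree_eq_sum_if_adj_nat, Fintype.sum_sum_type, SimpleGraph.rootedDegree]
  by_cases hi : i = u <;> simp [hi]

theorem degree_attachPendants_inr (j : β)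
    [Fintype ((attachPendants β H u).neighborSet (.inr j))] :
    (attachPendants β H u).degree (.inr j) = 1 := by
  simp only [SimpleGraph.degree_eq_sum_if_adj_nat, Fintype.sum_sum_type]
  simp

theorem lapMatrix_joinTrees : (joinTrees H T u v).lapMatrix ℝ =
    Matrix.fromBlocks (H.rootedLap u 1)
      (Matrix.of fun i j ↦ if i = u ∧ j ∈ ({v} : Finset β) then (-1 : ℝ) else 0)
      (Matrix.of fun j i ↦ if i = u then ((-1 : ℝ) • Pi.single v (1 : ℝ) : β → ℝ) j else 0)
      (T.rootedLap v 1) := by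
  ext (i | i) (j | j)
  · by_cases hij : i = j
    · subst hij
      simp [SimpleGraph.lapMatrix_apply_self, SimpleGraph.rootedLap_apply, degree_joinTrees_inl]
    · simp [SimpleGraph.lapMatrix_apply_of_ne, SimpleGraph.rootedLap_apply, hij]
  · simp [SimpleGraph.lapMatrix_apply_of_ne]
  · by_cases hj : j = u <;> simp [SimpleGraph.lapMatrix_apply_of_ne, Pi.single_apply, hj]
  · by_cases hij : i = j
    · subst hij
      simp [SimpleGraph.lapMatrix_apply_self, SimpleGraph.rootedLap_apply, degree_joinTrees_inr]
    · simp [SimpleGraph.lapMatrix_apply_of_ne, SimpleGraph.rootedLap_apply, hij]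

theorem lapMatrix_attachPendants : (attachPendants β H u).lapMatrix ℝ =
    Matrix.fromBlocks (H.rootedLap u (Fintype.card β))
      (Matrix.of fun i j ↦ if i = u ∧ j ∈ (Finset.univ : Finset β) then (-1 : ℝ) else 0)
      (Matrix.of fun _ i ↦ if i = u then (-1 : ℝ) else 0) 1 := by
  ext (i | i) (j | j)
  · by_cases hij : i = j
    · subst hij
      simp [SimpleGraph.lapMatrix_apply_self, SimpleGraph.rootedLap_apply,
        degree_attachPendants_inl]
    · simp [SimpleGraph.lapMatrix_apply_of_ne, SimpleGraph.rootedLap_apply, hij]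
  · simp [SimpleGraph.lapMatrix_apply_of_ne]
  · simp [SimpleGraph.lapMatrix_apply_of_ne]
  · by_cases hij : i = j
    · subst hij
      simp [SimpleGraph.lapMatrix_apply_self, degree_attachPendants_inr]
    · simp [SimpleGraph.lapMatrix_apply_of_ne, hij]

theorem permL_joinTrees : permL (joinTrees H T u v) =
    (permL H + H.minorPermL u) * (permL T + T.minorPermL v) +
      H.minorPermL u * T.minorPermL v := by
  have h := Matrix.permanent_fromBlocks_single_row_col (H.rootedLap u 1) (T.rootedLap v 1) u
    (fun _ ↦ (-1 : ℝ)) ((-1 : ℝ) • Pi.single v (1 : ℝ)) {v}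
  rw [← lapMatrix_joinTrees] at h
  rw [Finset.sum_singleton, Matrix.permanent_updateCol_smul] at h
  simp only [SimpleGraph.permanent_rootedLap, SimpleGraph.permanent_rootedLap_updateCol] at h
  rw [SimpleGraph.permL_eq, h]
  push_cast
  ring

theorem permL_attachPendants : permL (attachPendants β H u) =
    permL H + 2 * Fintype.card β * H.minorPermL u := by
  have h := Matrix.permanent_fromBlocks_single_row_col (H.rootedLap u (Fintype.card β))
    (1 : Matrix β β ℝ) u (fun _ ↦ (-1 : ℝ)) (fun _ ↦ (-1 : ℝ)) Finset.univ
  rw [← lapMatrix_attachPendants] at h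
  simp only [SimpleGraph.permanent_rootedLap, SimpleGraph.permanent_rootedLap_updateCol,
    Matrix.permanent_updateCol_one, Matrix.permanent_one] at h
  rw [SimpleGraph.permL_eq, h]
  simp only [Finset.sum_const, Finset.card_univ, nsmul_eq_mul]
  ring

theorem PD_joinTrees : PD (joinTrees H T u v) =
    (∏ i, (H.rootedDegree u 1 i : ℝ)) * ∏ j, (T.rootedDegree v 1 j : ℝ) := by
  simp only [PD, Fintype.prod_sum_type, degree_joinTrees_inl, degree_joinTrees_inr]

theorem PD_attachPendants : PD (attachPendants β H u) =
    ∏ i, (H.rootedDegree u (Fintype.card β) i : ℝ) := by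
  simp [PD, Fintype.prod_sum_type, degree_attachPendants_inl, degree_attachPendants_inr]

end Join

/-- for any tree `T` on `r ≥ 1` vertices, `π(G₁) ≥ π(G₂)`. -/
theorem lapRatio_joinTrees_ge {α β : Type*} [Fintype α] [Fintype β]
    (r : ℕ) (hr : 1 ≤ r) (hβ : Fintype.card β = r)
    (H : SimpleGraph α) (T : SimpleGraph β) (hH : H.IsTree) (hT : T.IsTree)
    (u : α) (v : β) :
    lapRatio (attachPendants β H u) ≤ lapRatio (joinTrees H T u v) := by
  have hq := hH.one_le_prod_degree_erase u
  have ha := hH.one_le_minorPermL u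
  have hh := hH.degree_mul_minorPermL_le u
  have hc := hT.one_le_minorPermL v
  have hp := hT.two_mul_prod_rootedDegree_le_permL v
  have hN : (r : ℝ) ≤ ∏ j, (T.rootedDegree v 1 j : ℝ) := by
    rw [← hβ]
    exact_mod_cast hT.card_le_prod_rootedDegree v
  have hr' : (1 : ℝ) ≤ r := by exact_mod_cast hr
  have hd : (0 : ℝ) ≤ H.degree u := Nat.cast_nonneg _
  rw [lapRatio, lapRatio, permL_joinTrees, permL_attachPendants, PD_joinTrees, PD_attachPendants,
    H.prod_rootedDegree, H.prod_rootedDegree, hβ, Nat.cast_one]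
  generalize (∏ j, (T.rootedDegree v 1 j : ℝ)) = N at *
  generalize (∏ i ∈ Finset.univ.erase u, (H.degree i : ℝ)) = q at *
  generalize H.minorPermL u = a at *
  generalize T.minorPermL v = c at *
  generalize permL H = h at *
  generalize permL T = p at *
  generalize (H.degree u : ℝ) = d at *
  generalize (r : ℝ) = r at *
  have hcoeff : 0 ≤ N * (d - 1 + 2 * r) - d - r := by
    nlinarith [mul_nonneg hd (sub_nonneg.2 hr'),
      mul_nonneg (sub_nonneg.2 hN) (by linarith : 0 ≤ d - 1 + 2 * r)]
  have key : (h + 2 * r * a) * ((d + 1) * N) ≤ ((h + a) * (p + c) + a * c) * (d + r) := by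
    have hdr : 0 ≤ d + r := by linarith
    have h₁ : h * (2 * N - 1) + a * (2 * N) ≤ (h + a) * (p + c) + a * c := by
      have h₀ : 0 ≤ h := (mul_nonneg hd (by linarith)).trans hh
      nlinarith [mul_nonneg h₀ (by linarith : 0 ≤ p + c - (2 * N - 1)),
        mul_nonneg (by linarith : 0 ≤ a) (by linarith : 0 ≤ p + 2 * c - 2 * N)]
    have h₂ : 0 ≤ d * a * (N * (d + 1) - d - r) := by
      refine mul_nonneg (mul_nonneg hd (by linarith)) ?_
      nlinarith [mul_nonneg hd (sub_nonneg.2 hr')]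
    nlinarith [mul_le_mul_of_nonneg_right h₁ hdr,
      mul_nonneg (sub_nonneg.2 hh) hcoeff]
  have hN' : 0 < N := by linarith
  have hq' : 0 < q := by linarith
  rw [div_le_div_iff₀ (by positivity) (by positivity)]
  nlinarith [mul_le_mul_of_nonneg_right key (by linarith : 0 ≤ q)]
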